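/- (Corollary 2) Let G be a position independent generalized Cops and Robbers game with Pursuer position digraph G_P and Evader position digraph G_E. If G_P is strongly connected and there exists X ⊆ P_P such that the set of allowed start positions is I = X × P_E, then the Pursuer has a winning strategy in G if and only if the stabilized relation ≼ is all of P_E × P_P (i.e., q_E ≼ p_P for every q_E ∈ P_E and p_P ∈ P_P). -/

import Mathlib

open Classical

/-- A generalized Cops and Robbers game on Pursuer positions `PP` and Evader positions `PE`.
`F` is the set of final positions, `I` the set of allowed start positions, and
`AP`/`AE` give the (nonempty) sets of allowed moves of the Pursuer/Evader from a
non-final position (a move changes only that player's own coordinate). -/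
structure GCR (PP PE : Type*) where
  F : PP → PE → Prop
  I : PP → PE → Prop
  AP : PP → PE → Set PP
  AE : PP → PE → Set PE
  I_nonempty : ∃ p q, I p q
  AP_nonempty : ∀ p q, ¬ F p q → (AP p q).Nonempty
  AE_nonempty : ∀ p q, ¬ F p q → (AE p q).Nonempty

namespace GCR

variable {PP PE : Type*}

/-- The Pursuer's allowed start positions `I_P`. -/
def IP (G : GCR PP PE) (p : PP) : Prop := ∃ q, G.I p q

/-- The Evader's allowed start positions `I_E(p)` against the Pursuer start `p`. -/
def IE (G : GCR PP PE) (p : PP) (q : PE) : Prop := G.I p q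

/-- The sequence of relations `≼_i` from Evader positions to Pursuer positions:
`q ≼_0 p` iff `(p,q) ∈ F`; and for `i ≥ 1`, `q ≼_i p` iff `(p,q) ∈ F` or for every
`x ∈ A_E(p,q)` either `(p,x) ∈ F` or there is `w ∈ A_P(p,x)` with `x ≼_j w` for some `j < i`. -/
def rel (G : GCR PP PE) : ℕ → PE → PP → Prop
  | 0, q, p => G.F p q
  | (i+1), q, p => G.F p q ∨
      ∀ x ∈ G.AE p q, G.F p x ∨ ∃ w ∈ G.AP p x, ∃ j, ∃ _ : j < i + 1, G.rel j x w
  termination_by i _ _ => i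
  decreasing_by omega

/-- The stabilized relation `≼`. -/
def Rel (G : GCR PP PE) (q : PE) (p : PP) : Prop := ∃ i, G.rel i q p

/-- A strategy for the Pursuer: an initial position together with a move for every
finite history of positions (most recent first). -/
structure PStrat (G : GCR PP PE) where
  init : PP
  move : List (PP × PE) → PP

/-- A strategy for the Evader: an initial position (depending on the Pursuer's choice)
together with a move for every finite history of positions (most recent first). -/
structure EStrat (G : GCR PP PE) where
  init : PP → PE
  move : List (PP × PE) → PE

/-- A Pursuer strategy plays allowed moves at every non-final position. -/
def PStrat.MovesValid {G : GCR PP PE} (σ : PStrat G) : Prop :=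
  ∀ (h : List (PP × PE)) (c : PP × PE), ¬ G.F c.1 c.2 → σ.move (c :: h) ∈ G.AP c.1 c.2

/-- An Evader strategy plays allowed moves at every non-final position. -/
def EStrat.MovesValid {G : GCR PP PE} (τ : EStrat G) : Prop :=
  ∀ (h : List (PP × PE)) (c : PP × PE), ¬ G.F c.1 c.2 → τ.move (c :: h) ∈ G.AE c.1 c.2

/-- A valid Pursuer strategy: the initial position is an allowed start position,
and all moves are allowed. -/
def PStrat.Valid {G : GCR PP PE} (σ : PStrat G) : Prop :=
  G.IP σ.init ∧ σ.MovesValid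

/-- A valid Evader strategy: the initial position is an allowed response to any allowed
Pursuer start position, and all moves are allowed. -/
def EStrat.Valid {G : GCR PP PE} (τ : EStrat G) : Prop :=
  (∀ p, G.IP p → G.IE p (τ.init p)) ∧ τ.MovesValid

/-- The play of the game determined by strategies `σ` and `τ`: first both players choose
their start positions, then they move alternately with the Pursuer moving first.
Returns the current position after `n` single moves together with the history so far. -/
def play (G : GCR PP PE) (σ : PStrat G) (τ : EStrat G) : ℕ → (PP × PE) × List (PP × PE)
  | 0 => ((σ.init, τ.init σ.init), [(σ.init, τ.init σ.init)])
  | (n+1) =>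
      let s := play G σ τ n
      let nxt := if n % 2 = 0 then (σ.move s.2, s.1.2) else (s.1.1, τ.move s.2)
      (nxt, nxt :: s.2)

/-- The position after `n` single moves of the play determined by `σ` and `τ`. -/
def pos (G : GCR PP PE) (σ : PStrat G) (τ : EStrat G) (n : ℕ) : PP × PE :=
  (play G σ τ n).1

/-- Play from a given mid-game position `start`; `pFirst = true` means the Pursuer is
next to move. The players move alternately. Returns the current position after `n`
single moves together with the history so far. -/
def playFrom (G : GCR PP PE) (σ : PStrat G) (τ : EStrat G) (start : PP × PE)
    (pFirst : Bool) : ℕ → (PP × PE) × List (PP × PE)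
  | 0 => (start, [start])
  | (n+1) =>
      let s := playFrom G σ τ start pFirst n
      let nxt := if (decide (n % 2 = 0)) == pFirst
        then (σ.move s.2, s.1.2) else (s.1.1, τ.move s.2)
      (nxt, nxt :: s.2)

/-- The position after `n` single moves of the play from state `(start, pFirst)`. -/
def posFrom (G : GCR PP PE) (σ : PStrat G) (τ : EStrat G) (start : PP × PE)
    (pFirst : Bool) (n : ℕ) : PP × PE :=
  (playFrom G σ τ start pFirst n).1

/-- The Pursuer has a winning strategy: a valid strategy such that against every valid
Evader strategy the position eventually belongs to `F`. -/
def PursuerWins (G : GCR PP PE) : Prop :=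
  ∃ σ : PStrat G, σ.Valid ∧ ∀ τ : EStrat G, τ.Valid →
    ∃ n, G.F (pos G σ τ n).1 (pos G σ τ n).2

/-- The Evader has a winning strategy: a valid strategy such that against every valid
Pursuer strategy the position never belongs to `F`. -/
def EvaderWins (G : GCR PP PE) : Prop :=
  ∃ τ : EStrat G, τ.Valid ∧ ∀ σ : PStrat G, σ.Valid →
    ∀ n, ¬ G.F (pos G σ τ n).1 (pos G σ τ n).2

/-! ### The state digraph and its labelling -/

/-- The initial labelling of the state digraph: final states get `0`, all others `∞`.
A state is a position together with a `Bool` which is `true` when the Pursuer is next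
to move. -/
noncomputable def labelInit (G : GCR PP PE) : (PP × PE) × Bool → ℕ∞ :=
  fun s => if G.F s.1.1 s.1.2 then 0 else ⊤

/-- One round of updates of the labelling procedure: a non-final Pursuer-to-move state
gets `1 +` the minimum label over its out-neighbours, and a non-final Evader-to-move
state gets `1 +` the maximum label over its out-neighbours. -/
noncomputable def labelStep (G : GCR PP PE) (f : (PP × PE) × Bool → ℕ∞) :
    (PP × PE) × Bool → ℕ∞ :=
  fun s =>
    if G.F s.1.1 s.1.2 then 0
    else if s.2 then 1 + ⨅ w ∈ G.AP s.1.1 s.1.2, f ((w, s.1.2), false)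
    else 1 + ⨆ x ∈ G.AE s.1.1 s.1.2, f ((s.1.1, x), true)

/-- The stable labelling of the state digraph, obtained by repeating the update
procedure until no label changes (the iterates decrease pointwise, so the stable
labelling is the pointwise infimum of the iterates). -/
noncomputable def label (G : GCR PP PE) (s : (PP × PE) × Bool) : ℕ∞ :=
  ⨅ n : ℕ, (G.labelStep)^[n] G.labelInit s

/-! ### Length of the game -/

/-- The number of moves the Pursuer makes before the position first lies in `F`, in the
play determined by `σ` and `τ` (the Pursuer moves at odd time-steps, so has made
`(n+1)/2` moves by time-step `n`); `⊤` if the position never lies in `F`. -/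
noncomputable def captureMoves (G : GCR PP PE) (σ : PStrat G) (τ : EStrat G) : ℕ∞ :=
  ⨅ (n : ℕ) (_ : G.F (pos G σ τ n).1 (pos G σ τ n).2), (((n + 1) / 2 : ℕ) : ℕ∞)

/-- The length of the game under optimal play: the minimum over valid Pursuer strategies
of the maximum over valid Evader strategies of the number of Pursuer moves made before
the position first lies in `F`. -/
noncomputable def gameLength (G : GCR PP PE) : ℕ∞ :=
  ⨅ (σ : PStrat G) (_ : σ.Valid), ⨆ (τ : EStrat G) (_ : τ.Valid), G.captureMoves σ τ

/-- The quantity `ℓ(p,q)` from Corollary 1. -/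
noncomputable def ell (G : GCR PP PE) (p : PP) (q : PE) : ℕ∞ :=
  if G.Rel q p then ⨅ (j : ℕ) (_ : G.rel j q p), (j : ℕ∞)
  else 1 + ⨆ w ∈ G.AP p q, ⨅ (j : ℕ) (_ : G.rel j q w), (j : ℕ∞)

/-! ### Position independent games -/

/-- A game is position independent (with position digraphs given by out-neighbour maps
`GP` and `GE`) if, from any non-final position, the allowed moves of the Pursuer depend
only on the Pursuer's position and the allowed moves of the Evader depend only on the
Evader's position. -/
def PositionIndependent (G : GCR PP PE) (GP : PP → Set PP) (GE : PE → Set PE) : Prop :=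
  ∀ p q, ¬ G.F p q → G.AP p q = GP p ∧ G.AE p q = GE q

/-- A vertex `(p,q)` of the round summary digraph is removable with respect to a set `S`
of vertices. -/
def Removable (G : GCR PP PE) (GP : PP → Set PP) (GE : PE → Set PE)
    (v : PP × PE) (S : Set (PP × PE)) : Prop :=
  G.F v.1 v.2 ∨ ∀ x ∈ GE v.2, G.F v.1 x ∨ ∃ y ∈ GP v.1, (y, x) ∈ S

/-- A removable vertex ordering of the round summary digraph: a sequence of vertices in
which each element is removable with respect to the set of vertices preceding it, and
there is a Pursuer start position `p ∈ I_P` such that for all `q ∈ I_E(p)` either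
`(p,q) ∈ F` or the Pursuer has an allowed move `w` with `(w,q)` in the sequence. -/
def RemovableOrdering (G : GCR PP PE) (GP : PP → Set PP) (GE : PE → Set PE)
    (L : List (PP × PE)) : Prop :=
  (∀ i : Fin L.length, G.Removable GP GE (L.get i)
      {w | ∃ j : Fin L.length, (j : ℕ) < (i : ℕ) ∧ L.get j = w}) ∧
  ∃ p, G.IP p ∧ ∀ q, G.IE p q → G.F p q ∨ ∃ w ∈ GP p, (w, q) ∈ L


theorem rel_succ_iff (G : GCR PP PE) (i : ℕ) (q : PE) (p : PP) :
    G.rel (i + 1) q p ↔ G.F p q ∨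
      ∀ x ∈ G.AE p q, G.F p x ∨ ∃ w ∈ G.AP p x, ∃ j, j < i + 1 ∧ G.rel j x w := by
  rw [rel]
  simp only [exists_prop]

theorem Rel.of_final {G : GCR PP PE} {q : PE} {p : PP} (h : G.F p q) : G.Rel q p :=
  ⟨0, by rwa [rel]⟩

/-- The stabilized relation is closed under one round of play. -/
theorem Rel.of_forall_move [Finite PE] {G : GCR PP PE} {q : PE} {p : PP}
    (h : ∀ x ∈ G.AE p q, G.F p x ∨ ∃ w ∈ G.AP p x, G.Rel x w) : G.Rel q p := by
  have bound : ∀ x, ∃ j, x ∈ G.AE p q → G.F p x ∨ ∃ w ∈ G.AP p x, G.rel j x w := by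
    intro x
    by_cases hx : x ∈ G.AE p q
    · rcases h x hx with hF | ⟨w, hw, j, hj⟩
      · exact ⟨0, fun _ => Or.inl hF⟩
      · exact ⟨j, fun _ => Or.inr ⟨w, hw, hj⟩⟩
    · exact ⟨0, fun hx' => absurd hx' hx⟩
  choose j hj using bound
  obtain ⟨N, hN⟩ := (Set.finite_range j).bddAbove
  refine ⟨N + 1, (G.rel_succ_iff N q p).2 (Or.inr fun x hx => (hj x hx).imp_right ?_)⟩
  rintro ⟨w, hw, hr⟩
  exact ⟨w, hw, j x, Nat.lt_succ_of_le (hN ⟨x, rfl⟩), hr⟩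

theorem play_snd (G : GCR PP PE) (σ : PStrat G) (τ : EStrat G) (n : ℕ) :
    ∃ t, (play G σ τ n).2 = pos G σ τ n :: t := by
  cases n with
  | zero => exact ⟨[], rfl⟩
  | succ n => exact ⟨(play G σ τ n).2, rfl⟩

theorem pos_succ_of_even (G : GCR PP PE) (σ : PStrat G) (τ : EStrat G) {n : ℕ}
    (hn : n % 2 = 0) :
    ∃ t, pos G σ τ (n + 1) = (σ.move (pos G σ τ n :: t), (pos G σ τ n).2) := by
  obtain ⟨t, ht⟩ := play_snd G σ τ n
  refine ⟨t, ?_⟩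
  rw [← ht]
  simp [pos, play, hn]

theorem pos_succ_of_odd (G : GCR PP PE) (σ : PStrat G) (τ : EStrat G) {n : ℕ}
    (hn : n % 2 = 1) :
    ∃ t, pos G σ τ (n + 1) = ((pos G σ τ n).1, τ.move (pos G σ τ n :: t)) := by
  obtain ⟨t, ht⟩ := play_snd G σ τ n
  refine ⟨t, ?_⟩
  rw [← ht]
  simp [pos, play, hn]

/-- A legal Pursuer move minimizing the index of the resulting related pair. -/
theorem exists_minimizing_move (G : GCR PP PE) (p : PP) (q : PE) :
    ∃ w, ¬ G.F p q → w ∈ G.AP p q ∧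
      ∀ i, (∃ v ∈ G.AP p q, G.rel i q v) → ∃ j ≤ i, G.rel j q w := by
  by_cases hF : G.F p q
  · exact ⟨p, fun h => absurd hF h⟩
  by_cases h : ∃ i, ∃ v ∈ G.AP p q, G.rel i q v
  · obtain ⟨w, hw, hr⟩ := Nat.find_spec h
    exact ⟨w, fun _ => ⟨hw, fun i hi => ⟨Nat.find h, Nat.find_min' h hi, hr⟩⟩⟩
  · obtain ⟨w, hw⟩ := G.AP_nonempty p q hF
    exact ⟨w, fun _ => ⟨hw, fun i hi => absurd ⟨i, hi⟩ h⟩⟩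

theorem pursuerWins_of_start (G : GCR PP PE) {p : PP} (hp : G.IP p)
    (h : ∀ q, G.IE p q → G.F p q ∨ ∃ w ∈ G.AP p q, G.Rel q w) : G.PursuerWins := by
  choose f hf using G.exists_minimizing_move
  let σ : PStrat G := ⟨p, fun l => l.head?.elim p fun c => f c.1 c.2⟩
  refine ⟨σ, ⟨hp, fun _ c hc => (hf c.1 c.2 hc).1⟩, fun τ hτ => ?_⟩
  have descend : ∀ i n, n % 2 = 1 → G.rel i (pos G σ τ n).2 (pos G σ τ n).1 →
      ∃ m, G.F (pos G σ τ m).1 (pos G σ τ m).2 := by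
    intro i
    induction i using Nat.strong_induction_on with
    | _ i ih =>
      intro n hn hi
      by_cases hF : G.F (pos G σ τ n).1 (pos G σ τ n).2
      · exact ⟨n, hF⟩
      cases i with
      | zero => exact ⟨n, by rwa [rel] at hi⟩
      | succ i =>
        obtain ⟨t, ht⟩ := pos_succ_of_odd G σ τ hn
        obtain ⟨s, hs⟩ := pos_succ_of_even G σ τ (n := n + 1) (by omega)
        have hmove := ((G.rel_succ_iff i _ _).1 hi).resolve_left hF _ (hτ.2 t _ hF)
        by_cases hF' : G.F (pos G σ τ (n + 1)).1 (pos G σ τ (n + 1)).2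
        · exact ⟨n + 1, hF'⟩
        have hx : τ.move (pos G σ τ n :: t) = (pos G σ τ (n + 1)).2 := by rw [ht]
        have hp' : (pos G σ τ n).1 = (pos G σ τ (n + 1)).1 := by rw [ht]
        rw [hx, hp'] at hmove
        obtain ⟨w, hw, j, hj, hr⟩ := hmove.resolve_left hF'
        obtain ⟨k, hk, hr'⟩ := (hf _ _ hF').2 j ⟨w, hw, hr⟩
        refine ih k (by omega) (n + 1 + 1) (by omega) ?_
        rw [hs]
        exact hr'
  by_cases hF : G.F p (τ.init p)
  · exact ⟨0, hF⟩
  obtain ⟨w, hw, i, hr⟩ := (h _ (hτ.1 p hp)).resolve_left hF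
  obtain ⟨j, -, hj⟩ := (hf _ _ hF).2 i ⟨w, hw, hr⟩
  exact descend j 1 rfl hj

theorem exists_start_of_pursuerWins [Finite PE] (G : GCR PP PE) (h : G.PursuerWins) :
    ∃ p, G.IP p ∧ ∀ q, G.IE p q → G.F p q ∨ ∃ w ∈ G.AP p q, G.Rel q w := by
  obtain ⟨σ, hσ, hwin⟩ := h
  refine ⟨σ.init, hσ.1, fun q₀ hq₀ => ?_⟩
  by_contra hcon
  push Not at hcon
  have start : ∀ p, ∃ q, (G.IP p → G.IE p q) ∧ (p = σ.init → q = q₀) := by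
    intro p
    by_cases hp : p = σ.init
    · exact ⟨q₀, fun _ => hp ▸ hq₀, fun _ => rfl⟩
    by_cases hI : G.IP p
    · obtain ⟨q, hq⟩ := hI
      exact ⟨q, fun _ => hq, fun h => absurd h hp⟩
    · exact ⟨q₀, fun h => absurd h hI, fun h => absurd h hp⟩
  have escape : ∀ p q, ∃ x, (¬ G.F p q → x ∈ G.AE p q) ∧
      (¬ G.Rel q p → ¬ G.F p x ∧ ∀ w ∈ G.AP p x, ¬ G.Rel x w) := by
    intro p q
    by_cases hR : G.Rel q p
    · by_cases hF : G.F p q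
      · exact ⟨q, fun h => absurd hF h, fun h => absurd hR h⟩
      · obtain ⟨x, hx⟩ := G.AE_nonempty p q hF
        exact ⟨x, fun _ => hx, fun h => absurd hR h⟩
    · have hx := mt Rel.of_forall_move hR
      push Not at hx
      obtain ⟨x, hx, hesc⟩ := hx
      exact ⟨x, fun _ => hx, fun _ => hesc⟩
  choose g hgI hg₀ using start
  choose f hfA hfR using escape
  let τ : EStrat G := ⟨g, fun l => l.head?.elim q₀ fun c => f c.1 c.2⟩
  have hτ : τ.Valid := ⟨hgI, fun _ c hc => hfA c.1 c.2 hc⟩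
  obtain ⟨n, hn⟩ := hwin τ hτ
  have evade : ∀ n,
      (n % 2 = 0 → ¬ G.F (pos G σ τ n).1 (pos G σ τ n).2 ∧
        ∀ w ∈ G.AP (pos G σ τ n).1 (pos G σ τ n).2, ¬ G.Rel (pos G σ τ n).2 w) ∧
      (n % 2 = 1 → ¬ G.Rel (pos G σ τ n).2 (pos G σ τ n).1) := by
    intro n
    induction n with
    | zero =>
      refine ⟨fun _ => ?_, fun h => absurd h (by decide)⟩
      have h0 : pos G σ τ 0 = (σ.init, q₀) := Prod.ext rfl (hg₀ σ.init rfl)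
      rw [h0]
      exact hcon
    | succ n ih =>
      refine ⟨fun hn => ?_, fun hn => ?_⟩
      · obtain ⟨t, ht⟩ := pos_succ_of_odd G σ τ (n := n) (by omega)
        rw [ht]
        exact hfR _ _ (ih.2 (by omega))
      · obtain ⟨t, ht⟩ := pos_succ_of_even G σ τ (n := n) (by omega)
        obtain ⟨hF, hR⟩ := ih.1 (by omega)
        rw [ht]
        exact hR _ (hσ.2 t _ hF)
  rcases Nat.mod_two_eq_zero_or_one n with h | h
  · exact ((evade n).1 h).1 hn
  · exact (evade n).2 h (Rel.of_final hn)

/-- The Pursuer wins exactly when some start position allows a first move into the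
stabilized relation against every Evader response. -/
theorem pursuerWins_iff_exists_start [Finite PE] (G : GCR PP PE) :
    G.PursuerWins ↔
      ∃ p, G.IP p ∧ ∀ q, G.IE p q → G.F p q ∨ ∃ w ∈ G.AP p q, G.Rel q w :=
  ⟨G.exists_start_of_pursuerWins, fun ⟨_, hp, h⟩ => G.pursuerWins_of_start hp h⟩

/-- Corollary 2: let `G` be a position independent game with position digraphs `GP` and
`GE`.  If `GP` is strongly connected and the set of allowed start positions is
`I = X × P_E` for some `X ⊆ P_P`, then the Pursuer has a winning strategy if and only if
the stabilized relation `≼` is all of `P_E × P_P`. -/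
theorem pursuerWins_iff_rel_full [Fintype PP] [Fintype PE] (G : GCR PP PE)
    (GP : PP → Set PP) (GE : PE → Set PE) (hPI : G.PositionIndependent GP GE)
    (hSC : ∀ a b : PP, Relation.ReflTransGen (fun u v => v ∈ GP u) a b)
    (X : Set PP) (hI : ∀ p q, G.I p q ↔ p ∈ X) :
    G.PursuerWins ↔ ∀ (q : PE) (p : PP), G.Rel q p := by
  rw [pursuerWins_iff_exists_start]
  constructor
  · rintro ⟨p, hp, h⟩ q a
    obtain ⟨q', hq'⟩ := hp
    have hX : p ∈ X := (hI p q').1 hq'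
    induction hSC a p using Relation.ReflTransGen.head_induction_on generalizing q with
    | refl => exact Rel.of_forall_move fun x _ => h x ((hI p x).2 hX)
    | head hstep _ ih =>
      refine Rel.of_forall_move fun x _ => or_iff_not_imp_left.2 fun hF => ?_
      exact ⟨_, (hPI _ x hF).1 ▸ hstep, ih x⟩
  · intro h
    obtain ⟨p, q, hpq⟩ := G.I_nonempty
    refine ⟨p, ⟨q, hpq⟩, fun x _ => or_iff_not_imp_left.2 fun hF => ?_⟩
    obtain ⟨w, hw⟩ := G.AP_nonempty p x hF
    exact ⟨w, hw, h x w⟩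

end GCR
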